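/- arXiv:2309.02152 — 5 statements merged into one kernel-verified Lean document; each statement's English description precedes it below -/
import Mathlib

section
/- Let n ≥ 1 and let λ > n be real. Let φ : 𝔹ⁿ → ℂ be bounded and continuous. If for every pair of multi-indices r, s ∈ ℕⁿ one has ∫_{𝔹ⁿ} φ(z) z^r conj(z^s) dμ_λ(z) = 0, then φ(z) = 0 for every z ∈ 𝔹ⁿ. (Equivalently, the Toeplitz quantization map φ ↦ T_φ^{(λ)}, T_φ^{(λ)}f = P_λ(φf), is injective on bounded continuous symbols.) -/
open MeasureTheory Complex

noncomputable section

/-- The open unit ball in ℂⁿ. -/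
def UnitBall (n : ℕ) : Set (Fin n → ℂ) := {z | ∑ i, ‖z i‖ ^ 2 < 1}

/-- The density of the weighted measure μ_λ with respect to Lebesgue measure. -/
def bergWeight (n : ℕ) (lam : ℝ) (z : Fin n → ℂ) : ℝ :=
  Real.Gamma lam / (Real.pi ^ n * Real.Gamma (lam - n)) *
    (1 - ∑ i, ‖z i‖ ^ 2) ^ (lam - n - 1)

/-- The weighted measure μ_λ on the unit ball. -/
def bergMeasure (n : ℕ) (lam : ℝ) : Measure (Fin n → ℂ) :=
  (volume.restrict (UnitBall n)).withDensity fun z => ENNReal.ofReal (bergWeight n lam z)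

open Set Metric Filter
open scoped ContDiff Topology

theorem continuous_sum_norm_sq (n : ℕ) :
    Continuous fun z : Fin n → ℂ => ∑ i, ‖z i‖ ^ 2 := by
  fun_prop

theorem isOpen_unitBall (n : ℕ) : IsOpen (UnitBall n) :=
  isOpen_lt (continuous_sum_norm_sq n) continuous_const

theorem unitBall_subset_closedBall (n : ℕ) : UnitBall n ⊆ closedBall 0 1 := by
  intro z hz
  rw [mem_closedBall_zero_iff, pi_norm_le_iff_of_nonneg zero_le_one]
  intro i
  have h : ‖z i‖ ^ 2 ≤ ∑ j, ‖z j‖ ^ 2 :=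
    Finset.single_le_sum (f := fun j => ‖z j‖ ^ 2) (fun j _ => by positivity) (Finset.mem_univ i)
  have hz : ∑ j, ‖z j‖ ^ 2 < 1 := hz
  exact (sq_le_one_iff₀ (norm_nonneg _)).1 (h.trans hz.le)

theorem integrableOn_one_sub_sq_rpow (d : ℕ) {a : ℝ} (ha : -1 < a) :
    IntegrableOn (fun y : ℝ => y ^ d • (1 - y ^ 2) ^ a) (Ioo 0 1) := by
  have h₁ : IntervalIntegrable (fun y : ℝ => (1 - y) ^ a) volume 0 1 := by
    simpa using ((intervalIntegral.intervalIntegrable_rpow' ha (a := 0) (b := 1)).comp_sub_left 1).symm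
  have h₂ : ContinuousOn (fun y : ℝ => y ^ d * (1 + y) ^ a) (uIcc 0 1) := by
    refine (continuousOn_id.pow d).mul ((continuousOn_const.add continuousOn_id).rpow_const ?_)
    intro y hy
    rw [uIcc_of_le zero_le_one] at hy
    have : 0 < 1 + y := by linarith [hy.1]
    exact Or.inl this.ne'
  have h₃ := (intervalIntegrable_iff_integrableOn_Ioo_of_le zero_le_one).1 (h₁.mul_continuousOn h₂)
  refine h₃.congr_fun (fun y hy => ?_) measurableSet_Ioo
  have hy₁ : 0 ≤ 1 - y := by linarith [hy.2]
  have hy₂ : 0 ≤ 1 + y := by linarith [hy.1]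
  simp only [smul_eq_mul]
  rw [show 1 - y ^ 2 = (1 - y) * (1 + y) by ring, Real.mul_rpow hy₁ hy₂]
  ring

theorem integrableOn_unitBall_one_sub_rpow {n : ℕ} (hn : 1 ≤ n) {a : ℝ} (ha : -1 < a) :
    IntegrableOn (fun z : Fin n → ℂ => (1 - ∑ i, ‖z i‖ ^ 2) ^ a) (UnitBall n) := by
  have : Nonempty (Fin n) := ⟨⟨0, hn⟩⟩
  let e : (Fin n → ℂ) ≃L[ℝ] EuclideanSpace ℂ (Fin n) :=
    (PiLp.continuousLinearEquiv 2 ℝ fun _ => ℂ).symm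
  have he : ∀ z : Fin n → ℂ, ‖e z‖ ^ 2 = ∑ i, ‖z i‖ ^ 2 := fun z =>
    EuclideanSpace.norm_sq_eq _
  have hm : MeasurePreserving e volume (volume.map e) := e.continuous.measurable.measurePreserving _
  have hpre : e ⁻¹' ball 0 1 = UnitBall n := by
    ext z
    rw [mem_preimage, mem_ball_zero_iff, ← sq_lt_one_iff₀ (norm_nonneg _), he]
    rfl
  have key := (integrableOn_fun_norm_addHaar ((volume : Measure (Fin n → ℂ)).map e)
    (f := fun y : ℝ => (1 - y ^ 2) ^ a) (r := 1)).2 (integrableOn_one_sub_sq_rpow _ ha)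
  rw [← hm.integrableOn_comp_preimage e.toHomeomorph.measurableEmbedding, hpre] at key
  simpa only [Function.comp_def, he] using key

theorem continuousOn_bergWeight (n : ℕ) (lam : ℝ) :
    ContinuousOn (bergWeight n lam) (UnitBall n) := by
  refine continuousOn_const.mul (ContinuousOn.rpow_const (by fun_prop) fun z hz => Or.inl ?_)
  have hz : ∑ i, ‖z i‖ ^ 2 < 1 := hz
  exact (sub_pos.2 hz).ne'

theorem bergWeight_pos {n : ℕ} {lam : ℝ} (hlam : (n : ℝ) < lam) {z : Fin n → ℂ}
    (hz : z ∈ UnitBall n) : 0 < bergWeight n lam z := by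
  have hz : ∑ i, ‖z i‖ ^ 2 < 1 := hz
  have h₁ : 0 < Real.Gamma lam := Real.Gamma_pos_of_pos (n.cast_nonneg.trans_lt hlam)
  have h₂ : 0 < Real.Gamma (lam - n) := Real.Gamma_pos_of_pos (sub_pos.2 hlam)
  have h₃ : 0 < (1 - ∑ i, ‖z i‖ ^ 2) ^ (lam - n - 1) := Real.rpow_pos_of_pos (sub_pos.2 hz) _
  unfold bergWeight
  positivity

theorem integrableOn_bergWeight {n : ℕ} (hn : 1 ≤ n) {lam : ℝ} (hlam : (n : ℝ) < lam) :
    IntegrableOn (bergWeight n lam) (UnitBall n) :=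
  (integrableOn_unitBall_one_sub_rpow hn (by linarith)).const_mul _

theorem integral_bergMeasure {n : ℕ} {lam : ℝ} (hlam : (n : ℝ) < lam) (g : (Fin n → ℂ) → ℂ) :
    ∫ z, g z ∂(bergMeasure n lam) = ∫ z in UnitBall n, (bergWeight n lam z : ℂ) * g z := by
  rw [bergMeasure, integral_withDensity_eq_integral_toReal_smul₀
    ((continuousOn_bergWeight n lam).aemeasurable (isOpen_unitBall n).measurableSet).ennreal_ofReal
    (by simp)]
  refine setIntegral_congr_fun (isOpen_unitBall n).measurableSet fun z hz => ?_
  simp [ENNReal.toReal_ofReal (bergWeight_pos hlam hz).le]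

section Polynomials

variable {ι : Type*} (K : Set (ι → ℂ))

/-- The variable indexed by `Sum.inl i` is sent to the coordinate `z i`, the one indexed by
`Sum.inr i` to its conjugate. -/
def coordinateOrConj : ι ⊕ ι → C(K, ℂ) :=
  Sum.elim (fun i => ⟨fun z => z.1 i, (continuous_apply i).comp continuous_subtype_val⟩)
    (fun i => ⟨fun z => (starRingEnd ℂ) (z.1 i),
      continuous_conj.comp ((continuous_apply i).comp continuous_subtype_val)⟩)

/-- The star subalgebra of polynomials in the coordinates and their conjugates. -/
def conjPolynomials : StarSubalgebra ℂ C(K, ℂ) where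
  toSubalgebra := (MvPolynomial.aeval (R := ℂ) (coordinateOrConj K)).range
  star_mem' := by
    rintro _ ⟨p, rfl⟩
    change star (MvPolynomial.aeval (R := ℂ) (coordinateOrConj K) p) ∈
      (MvPolynomial.aeval (R := ℂ) (coordinateOrConj K)).range
    induction p using MvPolynomial.induction_on with
    | C a =>
      refine ⟨MvPolynomial.C (star a), ?_⟩
      ext z
      simp
    | add p q hp hq =>
      rw [map_add, star_add]
      exact add_mem hp hq
    | mul_X p j hp =>
      rw [map_mul, star_mul', MvPolynomial.aeval_X]
      refine mul_mem hp ⟨MvPolynomial.X j.swap, ?_⟩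
      ext z
      cases j <;> simp [coordinateOrConj]

theorem conjPolynomials_separatesPoints : (conjPolynomials K).SeparatesPoints := by
  intro x y hxy
  obtain ⟨i, hi⟩ := Function.ne_iff.1 (Subtype.coe_ne_coe.2 hxy)
  refine ⟨_, ⟨_, ⟨MvPolynomial.X (Sum.inl i), rfl⟩, rfl⟩, ?_⟩
  simpa [coordinateOrConj] using hi

theorem exists_conjPolynomial_near (hK : IsCompact K) {g : (ι → ℂ) → ℂ} (hg : Continuous g)
    {ε : ℝ} (hε : 0 < ε) :
    ∃ p : MvPolynomial (ι ⊕ ι) ℂ, ∀ z ∈ K,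
      ‖MvPolynomial.eval (Sum.elim z fun i => (starRingEnd ℂ) (z i)) p - g z‖ < ε := by
  have : CompactSpace K := isCompact_iff_compactSpace.1 hK
  have htop := ContinuousMap.starSubalgebra_topologicalClosure_eq_top_of_separatesPoints
    (conjPolynomials K) (conjPolynomials_separatesPoints K)
  let G : C(K, ℂ) := ⟨fun z => g z, by fun_prop⟩
  have hG : G ∈ closure (conjPolynomials K : Set C(K, ℂ)) := by
    rw [← StarSubalgebra.topologicalClosure_coe, htop]
    trivial
  obtain ⟨_, ⟨p, rfl⟩, hp⟩ := Metric.mem_closure_iff.1 hG ε hε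
  refine ⟨p, fun z hz => ?_⟩
  have heval : (MvPolynomial.aeval (R := ℂ) (coordinateOrConj K) p) ⟨z, hz⟩ =
      MvPolynomial.eval (Sum.elim z fun i => (starRingEnd ℂ) (z i)) p := by
    clear hp
    induction p using MvPolynomial.induction_on with
    | C a => simp
    | add p q hp hq => simp [hp, hq]
    | mul_X p j hp =>
      rw [map_mul, map_mul, ContinuousMap.mul_apply, hp, MvPolynomial.aeval_X, MvPolynomial.eval_X]
      cases j <;> rfl
  rw [← heval, ← dist_eq_norm, dist_comm]
  exact (ContinuousMap.dist_apply_le_dist (f := G) ⟨z, hz⟩).trans_lt hp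

end Polynomials

/-- An integrable function on a bounded set that is orthogonal to all monomials
`z ^ r * conj z ^ s` is orthogonal to every continuous function. -/
theorem setIntegral_mul_eq_zero_of_monomials {ι : Type*} [Fintype ι] {U K : Set (ι → ℂ)}
    (hU : MeasurableSet U) (hK : IsCompact K) (hUK : U ⊆ K) {f : (ι → ℂ) → ℂ}
    (hf : IntegrableOn f U)
    (h : ∀ r s : ι → ℕ,
      ∫ z in U, f z * ((∏ i, z i ^ r i) * (starRingEnd ℂ) (∏ i, z i ^ s i)) = 0)
    {g : (ι → ℂ) → ℂ} (hg : Continuous g) : ∫ z in U, f z * g z = 0 := by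
  have hint : ∀ {q : (ι → ℂ) → ℂ}, Continuous q → IntegrableOn (fun z => f z * q z) U := by
    intro q hq
    obtain ⟨C, hC⟩ := hK.exists_bound_of_continuousOn hq.continuousOn
    refine Integrable.mul_bdd (c := C) hf hq.aestronglyMeasurable ?_
    filter_upwards [ae_restrict_mem hU] with z hz using hC z (hUK hz)
  have hcont : ∀ p : MvPolynomial (ι ⊕ ι) ℂ, Continuous fun z : ι → ℂ =>
      MvPolynomial.eval (Sum.elim z fun i => (starRingEnd ℂ) (z i)) p := by
    intro p
    refine p.continuous_eval.comp (continuous_pi fun j => ?_)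
    cases j <;> simp only [Sum.elim_inl, Sum.elim_inr] <;> fun_prop
  have hpoly : ∀ p : MvPolynomial (ι ⊕ ι) ℂ,
      ∫ z in U, f z * MvPolynomial.eval (Sum.elim z fun i => (starRingEnd ℂ) (z i)) p = 0 := by
    intro p
    induction p using MvPolynomial.induction_on' with
    | monomial m a =>
      rw [← mul_zero a, ← h (fun i => m (Sum.inl i)) (fun i => m (Sum.inr i)),
        ← integral_const_mul]
      refine integral_congr_ae (Eventually.of_forall fun z => ?_)
      simp [MvPolynomial.eval_monomial, Finsupp.prod_fintype, Fintype.prod_sum_type]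
      ring
    | add p q hp hq =>
      simp only [map_add, mul_add]
      rw [integral_add (hint (hcont p)) (hint (hcont q)), hp, hq, add_zero]
  set M := ∫ z in U, ‖f z‖ with hM
  have hM₀ : 0 ≤ M := integral_nonneg fun _ => norm_nonneg _
  refine norm_le_zero_iff.1 (le_of_forall_pos_le_add fun δ hδ => ?_)
  have hε : 0 < δ / (M + 1) := by positivity
  obtain ⟨p, hp⟩ := exists_conjPolynomial_near K hK hg hε
  calc ‖∫ z in U, f z * g z‖
      = ‖∫ z in U, (f z * g z -
          f z * MvPolynomial.eval (Sum.elim z fun i => (starRingEnd ℂ) (z i)) p)‖ := by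
        rw [integral_sub (hint hg) (hint (hcont p)), hpoly p, sub_zero]
    _ ≤ ∫ z in U, ‖f z‖ * (δ / (M + 1)) := by
        refine norm_integral_le_of_norm_le (hf.norm.mul_const _) ?_
        filter_upwards [ae_restrict_mem hU] with z hz
        rw [← mul_sub, norm_mul, norm_sub_rev]
        exact mul_le_mul_of_nonneg_left (hp z (hUK hz)).le (norm_nonneg _)
    _ = M * (δ / (M + 1)) := integral_mul_const _ _
    _ ≤ 0 + δ := by
        rw [zero_add, mul_div_assoc', div_le_iff₀ (by positivity)]
        nlinarith

/-- If a bounded continuous symbol φ on 𝔹ⁿ is orthogonal to all products z^r conj(z^s)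
with respect to μ_λ (λ > n), then φ vanishes identically on 𝔹ⁿ. -/
theorem toeplitz_quantization_injective
    (n : ℕ) (hn : 1 ≤ n) (lam : ℝ) (hlam : (n : ℝ) < lam)
    (φ : (Fin n → ℂ) → ℂ)
    (hφc : ContinuousOn φ (UnitBall n))
    (hφb : ∃ C : ℝ, ∀ z ∈ UnitBall n, ‖φ z‖ ≤ C)
    (h : ∀ r s : Fin n → ℕ,
      ∫ z, φ z * (∏ i, z i ^ r i) * (starRingEnd ℂ) (∏ i, z i ^ s i)
        ∂(bergMeasure n lam) = 0) :
    ∀ z ∈ UnitBall n, φ z = 0 := by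
  obtain ⟨C, hC⟩ := hφb
  have hU := isOpen_unitBall n
  have hwc : ContinuousOn (fun z => (bergWeight n lam z : ℂ)) (UnitBall n) :=
    continuous_ofReal.comp_continuousOn (continuousOn_bergWeight n lam)
  have hf : IntegrableOn (fun z => (bergWeight n lam z : ℂ) * φ z) (UnitBall n) := by
    refine Integrable.mul_bdd (c := C) (integrableOn_bergWeight hn hlam).ofReal
      (hφc.aestronglyMeasurable hU.measurableSet) ?_
    filter_upwards [ae_restrict_mem hU.measurableSet] with z hz using hC z hz
  have horth : ∀ g : (Fin n → ℂ) → ℂ, Continuous g →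
      ∫ z in UnitBall n, (bergWeight n lam z : ℂ) * φ z * g z = 0 := by
    intro g hg
    refine setIntegral_mul_eq_zero_of_monomials hU.measurableSet
      (isCompact_closedBall (0 : Fin n → ℂ) 1) (unitBall_subset_closedBall n) hf (fun r s => ?_) hg
    rw [← h r s, integral_bergMeasure hlam]
    simp only [mul_assoc]
  have hae : ∀ᵐ z, z ∈ UnitBall n → (bergWeight n lam z : ℂ) * φ z = 0 := by
    refine hU.ae_eq_zero_of_integral_contDiff_smul_eq_zero hf.locallyIntegrableOn
      fun g hg _ hsupp => ?_
    rw [← horth (fun z => (g z : ℂ)) (continuous_ofReal.comp hg.continuous),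
      ← setIntegral_eq_integral_of_forall_compl_eq_zero (s := UnitBall n)]
    · simp only [real_smul, mul_comm]
    · intro z hz
      rw [image_eq_zero_of_notMem_tsupport fun hz' => hz (hsupp hz'), zero_smul]
  have hzero := Measure.eqOn_open_of_ae_eq (μ := volume) (g := fun _ => 0)
    ((ae_restrict_iff' hU.measurableSet).2 hae) hU (hwc.mul hφc) continuousOn_const
  intro z hz
  exact (mul_eq_zero.1 (hzero hz)).resolve_left (ofReal_ne_zero.2 (bergWeight_pos hlam hz).ne')
end
end

section
/- Let Ω be a nonempty open connected subset of ℂⁿ and let Ω* = {conj(x) : x ∈ Ω} (coordinatewise complex conjugation). Let F : ℂⁿ × ℂⁿ → ℂ be complex-analytic on Ω × Ω* (i.e., F is holomorphic in the first variable and, after the substitution y ↦ conj(y), antiholomorphic in the second). If F(x, conj(x)) = 0 for every x ∈ Ω, then F(x,y) = 0 for every (x,y) ∈ Ω × Ω*. -/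
open Complex

noncomputable section

/-- Coordinatewise complex conjugation on ℂⁿ. -/
def conjVec (n : ℕ) (x : Fin n → ℂ) : Fin n → ℂ := fun i => (starRingEnd ℂ) (x i)

theorem image_conjVec_eq_preimage (n : ℕ) (s : Set (Fin n → ℂ)) :
    conjVec n '' s = conjVec n ⁻¹' s :=
  congrFun (Set.image_eq_preimage_of_inverse (f := conjVec n) (g := conjVec n)
    star_star star_star) s

theorem continuous_conjVec (n : ℕ) : Continuous (conjVec n) :=
  continuous_star

/-- Every `(h, k)` lies on the complex line through `(u, star u)` in direction `(v, star v)`. -/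
theorem exists_add_I_smul_star {n : ℕ} {ε : ℝ} {h k : Fin n → ℂ} (hh : ‖h‖ < ε) (hk : ‖k‖ < ε) :
    ∃ u v : Fin n → ℂ, ‖u‖ < ε ∧ ‖v‖ < ε ∧ h = u + I • v ∧ k = star u + I • star v := by
  have hk' : ‖star k‖ < ε := by rwa [norm_star]
  refine ⟨(1 / 2 : ℂ) • (h + star k), (-I / 2 : ℂ) • (h - star k), ?_, ?_, ?_, ?_⟩
  · rw [norm_smul]
    have := norm_add_le h (star k)
    norm_num
    linarith
  · rw [norm_smul]
    have := norm_sub_le h (star k)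
    norm_num
    linarith
  · ext i
    simp only [Pi.add_apply, Pi.smul_apply, Pi.sub_apply, smul_eq_mul]
    linear_combination ((h i - star k i) / 2) * I_mul_I
  · ext i
    simp
    linear_combination ((k i - (starRingEnd ℂ) (h i)) / 2) * I_mul_I

/-- An analytic function on a ball centred on the totally real subspace `{(x, star x)}` which
vanishes on that subspace vanishes near the centre. -/
theorem eventually_eq_zero_of_eq_zero_on_star_graph {n : ℕ} {F : (Fin n → ℂ) × (Fin n → ℂ) → ℂ}
    {a : Fin n → ℂ} {ε : ℝ} (hε : 0 < ε)
    (hF : AnalyticOnNhd ℂ F (Metric.ball (a, star a) ε))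
    (hdiag : ∀ x ∈ Metric.ball a ε, F (x, star x) = 0) :
    ∀ᶠ p in nhds (a, star a), F p = 0 := by
  filter_upwards [Metric.ball_mem_nhds (a, star a) (by positivity : 0 < ε / 3)] with p hp
  obtain ⟨x, y⟩ := p
  rw [Metric.mem_ball, Prod.dist_eq, max_lt_iff, dist_eq_norm, dist_eq_norm] at hp
  obtain ⟨u, v, hu, hv, hx, hy⟩ := exists_add_I_smul_star hp.1 hp.2
  have norm_lt : ∀ (b c : Fin n → ℂ) (z : ℂ), ‖b‖ < ε / 3 → ‖c‖ < ε / 3 → ‖z‖ < 2 →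
      ‖b + z • c‖ < ε := by
    intro b c z hb hc hz
    have h1 := norm_add_le b (z • c)
    rw [norm_smul] at h1
    nlinarith [norm_nonneg c, norm_nonneg z]
  let L : ℂ → (Fin n → ℂ) × (Fin n → ℂ) :=
    fun z => (a + (u + z • v), star a + (star u + z • star v))
  have hL : ∀ z ∈ Metric.ball (0 : ℂ) 2, L z ∈ Metric.ball (a, star a) ε := by
    intro z hz
    rw [mem_ball_zero_iff] at hz
    rw [Metric.mem_ball, Prod.dist_eq, max_lt_iff, dist_eq_norm, dist_eq_norm]
    simp only [L, add_sub_cancel_left]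
    exact ⟨norm_lt _ _ z hu hv hz,
      norm_lt _ _ z (by rwa [norm_star]) (by rwa [norm_star]) hz⟩
  have hLan : AnalyticOnNhd ℂ L (Metric.ball 0 2) := by
    have hd : Differentiable ℂ L := by fun_prop
    exact fun z _ => hd.analyticAt z
  have hreal : ∀ t : ℝ, (t : ℂ) ∈ Metric.ball (0 : ℂ) 2 → F (L t) = 0 := by
    intro t ht
    have hmem : a + (u + (t : ℂ) • v) ∈ Metric.ball a ε := by
      have := hL t ht
      rw [Metric.mem_ball, Prod.dist_eq, max_lt_iff] at this
      exact this.1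
    have := hdiag _ hmem
    simpa [L, star_smul] using this
  have hfreq : ∃ᶠ z in nhdsWithin (0 : ℂ) {0}ᶜ, (F ∘ L) z = 0 := by
    have ht : Filter.Tendsto (fun t : ℝ => (t : ℂ)) (nhdsWithin 0 {0}ᶜ)
        (nhdsWithin (0 : ℂ) {0}ᶜ) := by
      refine (continuous_ofReal.tendsto' 0 0 ofReal_zero).inf ?_
      simp
    refine ht.frequently (Filter.Eventually.frequently ?_)
    have h0 : Metric.ball (0 : ℂ) 2 ∈ nhdsWithin (0 : ℂ) {0}ᶜ :=
      mem_nhdsWithin_of_mem_nhds (Metric.ball_mem_nhds _ two_pos)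
    filter_upwards [ht h0] with t htb
    exact hreal t htb
  have hzero := (hF.comp hLan hL).eqOn_zero_of_preconnected_of_frequently_eq_zero
    (convex_ball (0 : ℂ) 2).isPreconnected (Metric.mem_ball_self two_pos) hfreq
  have hI := hzero (show I ∈ Metric.ball (0 : ℂ) 2 by simp)
  have hLI : L I = (x, y) := by
    simp only [L, ← hx, ← hy, add_sub_cancel]
  simpa [hLI] using hI

/-- If F(x,y) is complex-analytic on Ω × Ω* (holomorphic in x, antiholomorphic in ȳ)
and F vanishes on the "diagonal" {(x, conj x) : x ∈ Ω} for a nonempty open connected Ω,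
then F vanishes identically on Ω × Ω*. -/
theorem vanishing_on_diagonal
    (n : ℕ) (Ω : Set (Fin n → ℂ)) (hΩne : Ω.Nonempty) (hΩo : IsOpen Ω)
    (hΩc : IsConnected Ω)
    (F : (Fin n → ℂ) × (Fin n → ℂ) → ℂ)
    (hF : AnalyticOnNhd ℂ F (Ω ×ˢ (conjVec n '' Ω)))
    (hdiag : ∀ x ∈ Ω, F (x, conjVec n x) = 0) :
    ∀ p ∈ Ω ×ˢ (conjVec n '' Ω), F p = 0 := by
  obtain ⟨a, ha⟩ := hΩne
  have hopen : IsOpen (Ω ×ˢ (conjVec n '' Ω)) := by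
    rw [image_conjVec_eq_preimage]
    exact hΩo.prod (hΩo.preimage (continuous_conjVec n))
  have hconn : IsPreconnected (Ω ×ˢ (conjVec n '' Ω)) :=
    hΩc.isPreconnected.prod (hΩc.isPreconnected.image _ (continuous_conjVec n).continuousOn)
  have hmem : (a, conjVec n a) ∈ Ω ×ˢ (conjVec n '' Ω) := ⟨ha, a, ha, rfl⟩
  obtain ⟨ε, hε, hball⟩ := Metric.isOpen_iff.mp hopen _ hmem
  rw [← ball_prod_same] at hball
  have hlocal := eventually_eq_zero_of_eq_zero_on_star_graph hε
    (hF.mono (by rw [← ball_prod_same]; exact hball))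
    (fun x hx => hdiag x (hball (Set.mk_mem_prod hx (Metric.mem_ball_self hε))).1)
  exact hF.eqOn_zero_of_preconnected_of_eventuallyEq_zero hconn hmem hlocal
end
end

section
/- Let n ≥ 1 and let λ be a positive integer. Let g be a complex (n+1)×(n+1) matrix with gᴴ J g = J. Then for all z, w ∈ 𝔹ⁿ, d_{g⁻¹}(w)^{−λ} · (1 − ⟨g⁻¹·w, z⟩)^{−λ} = conj(d_g(z)^{−λ}) · (1 − ⟨w, g·z⟩)^{−λ}. (Equivalently, π_λ(g) K_z = conj(j_λ(g,z)) K_{g·z}, where K_z(w) = (1 − ⟨w,z⟩)^{−λ} and j_λ(g,z) = d_g(z)^{−λ}.) -/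
open Complex

noncomputable section

/-- The matrix J = diag(1,…,1,−1). -/
def Jmat (n : ℕ) : Matrix (Fin (n + 1)) (Fin (n + 1)) ℂ :=
  Matrix.diagonal fun i => if i = Fin.last n then -1 else 1

/-- ζ_z = (z, 1) ∈ ℂ^{n+1}. -/
def zeta (n : ℕ) (z : Fin n → ℂ) : Fin (n + 1) → ℂ := Fin.snoc z 1

/-- d_g(z): the last coordinate of g ζ_z. -/
def dCoc (n : ℕ) (g : Matrix (Fin (n + 1)) (Fin (n + 1)) ℂ) (z : Fin n → ℂ) : ℂ :=
  g.mulVec (zeta n z) (Fin.last n)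

/-- The Möbius action g·z = ((gζ_z)₁,…,(gζ_z)_n)/d_g(z). -/
def mob (n : ℕ) (g : Matrix (Fin (n + 1)) (Fin (n + 1)) ℂ) (z : Fin n → ℂ) :
    Fin n → ℂ :=
  fun i => g.mulVec (zeta n z) i.castSucc / dCoc n g z

/-- Hermitian pairing ⟨z,w⟩ = Σ zᵢ conj(wᵢ). -/
def herm (n : ℕ) (z w : Fin n → ℂ) : ℂ := ∑ i, z i * (starRingEnd ℂ) (w i)

open Matrix in
/-- The Hermitian form of signature `(n, 1)` attached to `Jmat n`, linear in the first argument. -/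
def jForm (n : ℕ) (u v : Fin (n + 1) → ℂ) : ℂ := star v ⬝ᵥ (Jmat n *ᵥ u)

theorem jForm_eq (n : ℕ) (u v : Fin (n + 1) → ℂ) :
    jForm n u v = ∑ i : Fin n, u i.castSucc * (starRingEnd ℂ) (v i.castSucc)
      - u (Fin.last n) * (starRingEnd ℂ) (v (Fin.last n)) := by
  have h (i : Fin n) : i.castSucc ≠ Fin.last n := (Fin.castSucc_lt_last i).ne
  simp [jForm, Jmat, dotProduct, Matrix.mulVec_diagonal, Fin.sum_univ_castSucc, h, mul_comm,
    sub_eq_add_neg]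

open Matrix in
theorem jForm_mulVec_right (n : ℕ) {g h : Matrix (Fin (n + 1)) (Fin (n + 1)) ℂ}
    (hgh : gᴴ * Jmat n = Jmat n * h) (u v : Fin (n + 1) → ℂ) :
    jForm n u (g *ᵥ v) = jForm n (h *ᵥ u) v := by
  rw [jForm, jForm, star_mulVec, ← dotProduct_mulVec, mulVec_mulVec, mulVec_mulVec, hgh]

theorem isUnit_det_of_preserves_Jmat {n : ℕ} {g : Matrix (Fin (n + 1)) (Fin (n + 1)) ℂ}
    (hg : g.conjTranspose * Jmat n * g = Jmat n) : IsUnit g.det := by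
  have hJ : (Jmat n).det ≠ 0 := by
    rw [Jmat, Matrix.det_diagonal, Finset.prod_ne_zero_iff]
    intro i _
    split_ifs <;> simp
  rw [isUnit_iff_ne_zero]
  intro h
  apply hJ
  rw [← hg, Matrix.det_mul, h, mul_zero]

theorem conjTranspose_mul_Jmat {n : ℕ} {g : Matrix (Fin (n + 1)) (Fin (n + 1)) ℂ}
    (hg : g.conjTranspose * Jmat n * g = Jmat n) :
    g.conjTranspose * Jmat n = Jmat n * g⁻¹ := by
  rw [← Matrix.mul_nonsing_inv_cancel_right g (g.conjTranspose * Jmat n)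
    (isUnit_det_of_preserves_Jmat hg), hg]

theorem inv_preserves_Jmat {n : ℕ} {g : Matrix (Fin (n + 1)) (Fin (n + 1)) ℂ}
    (hg : g.conjTranspose * Jmat n * g = Jmat n) :
    g⁻¹.conjTranspose * Jmat n * g⁻¹ = Jmat n := by
  rw [mul_assoc, ← conjTranspose_mul_Jmat hg, ← mul_assoc, ← Matrix.conjTranspose_mul,
    Matrix.mul_nonsing_inv _ (isUnit_det_of_preserves_Jmat hg), Matrix.conjTranspose_one, one_mul]

theorem dCoc_ne_zero {n : ℕ} {g : Matrix (Fin (n + 1)) (Fin (n + 1)) ℂ}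
    (hg : g.conjTranspose * Jmat n * g = Jmat n) {z : Fin n → ℂ} (hz : z ∈ UnitBall n) :
    dCoc n g z ≠ 0 := by
  intro h
  have key : jForm n (g.mulVec (zeta n z)) (g.mulVec (zeta n z)) =
      jForm n (zeta n z) (zeta n z) := by
    rw [jForm_mulVec_right n (conjTranspose_mul_Jmat hg), Matrix.mulVec_mulVec,
      Matrix.nonsing_inv_mul _ (isUnit_det_of_preserves_Jmat hg), Matrix.one_mulVec]
  rw [dCoc] at h
  rw [jForm_eq, jForm_eq, h, zero_mul, sub_zero] at key
  simp only [zeta, Fin.snoc_castSucc, Fin.snoc_last, Complex.mul_conj', map_one, mul_one] at key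
  norm_cast at key
  have hz' : ∑ i, ‖z i‖ ^ 2 < 1 := hz
  have hpos : 0 ≤ ∑ i : Fin n, ‖g.mulVec (zeta n z) i.castSucc‖ ^ 2 := by positivity
  simp only [zeta] at hpos
  linarith

theorem dCoc_mul_one_sub_herm {n : ℕ} {g : Matrix (Fin (n + 1)) (Fin (n + 1)) ℂ}
    {w : Fin n → ℂ} (h : dCoc n g w ≠ 0) (z : Fin n → ℂ) :
    dCoc n g w * (1 - herm n (mob n g w) z) = -jForm n (g.mulVec (zeta n w)) (zeta n z) := by
  have hd : g.mulVec (zeta n w) (Fin.last n) = dCoc n g w := rfl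
  rw [jForm_eq, hd, mul_sub, herm, Finset.mul_sum]
  simp only [zeta, Fin.snoc_castSucc, Fin.snoc_last, map_one, mul_one, neg_sub]
  congr 1
  refine Finset.sum_congr rfl fun i _ => ?_
  rw [mob, ← mul_assoc, mul_div_cancel₀ _ h, zeta]

theorem conj_herm (n : ℕ) (z w : Fin n → ℂ) : (starRingEnd ℂ) (herm n z w) = herm n w z := by
  simp [herm, mul_comm]

theorem conj_jForm (n : ℕ) (u v : Fin (n + 1) → ℂ) :
    (starRingEnd ℂ) (jForm n u v) = jForm n v u := by
  simp [jForm_eq, mul_comm]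

/-- π_λ(g) K_z = conj(j_λ(g,z)) K_{g·z} for the kernels K_z(w) = (1 − ⟨w,z⟩)^{−λ}. -/
theorem piLambda_acts_on_kernels
    (n : ℕ) (hn : 1 ≤ n) (lam : ℕ) (hlam : 0 < lam)
    (g : Matrix (Fin (n + 1)) (Fin (n + 1)) ℂ)
    (hg : g.conjTranspose * Jmat n * g = Jmat n) :
    ∀ z ∈ UnitBall n, ∀ w ∈ UnitBall n,
      dCoc n g⁻¹ w ^ (-(lam : ℤ)) *
          (1 - herm n (mob n g⁻¹ w) z) ^ (-(lam : ℤ))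
        = (starRingEnd ℂ) (dCoc n g z ^ (-(lam : ℤ))) *
          (1 - herm n w (mob n g z)) ^ (-(lam : ℤ)) := by
  intro z hz w hw
  have hinv := dCoc_mul_one_sub_herm (dCoc_ne_zero (inv_preserves_Jmat hg) hw) z
  have hconj := congrArg (starRingEnd ℂ) (dCoc_mul_one_sub_herm (dCoc_ne_zero hg hz) w)
  simp only [map_mul, map_sub, map_one, map_neg, conj_herm, conj_jForm] at hconj
  rw [map_zpow₀, ← mul_zpow, ← mul_zpow, hinv, hconj,
    jForm_mulVec_right n (conjTranspose_mul_Jmat hg)]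
end
end

section
/- Let n ≥ 1, let λ > 0 be real, and let m be a nonnegative integer with λ + 2m > n. For all multi-indices r, s ∈ ℕⁿ, [Π_{k=m}^{2m−1} (λ+k+|r|)/(λ+k)] · [Π_{k=0}^{m−1} (λ+k+|s|)/(λ+k)] · ∫_{𝔹ⁿ} z^r conj(z^s) dμ_{λ+2m}(z) = r!·Γ(λ)/Γ(λ+|r|) if r = s, and = 0 if r ≠ s. (This is the identity ⟨z^r, z^s⟩_{λ,#} = ⟨A_λ z^r, B_λ z^s⟩_{λ+2m} = δ(r,s) r! Γ(λ)/Γ(λ+|r|) for the analytically continued Bergman space inner product, since the Euler operator N = Σ_j z_j ∂/∂z_j satisfies (I + N/c) z^r = (1 + |r|/c) z^r, A_λ = (I + N/(λ+2m−1))⋯(I + N/(λ+m)) and B_λ = (I + N/(λ+m−1))⋯(I + N/λ).) -/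
open MeasureTheory Complex

noncomputable section

/-- The function equal to `x ^ p` for `x > 0` and to `0` elsewhere, valued in `ℝ≥0∞`. -/
def truncRpow (p x : ℝ) : ENNReal := ENNReal.ofReal (if 0 < x then x ^ p else 0)

@[fun_prop]
lemma measurable_truncRpow (p : ℝ) : Measurable (truncRpow p) :=
  (Measurable.ite measurableSet_Ioi (by fun_prop) (by fun_prop)).ennreal_ofReal

lemma lintegral_complex_comp_norm {f : ℝ → ENNReal} (hf : Measurable f) :
    ∫⁻ z : ℂ, f ‖z‖ =
      ENNReal.ofReal (2 * Real.pi) * ∫⁻ x in Set.Ioi (0 : ℝ), ENNReal.ofReal x * f x := by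
  rw [← Complex.lintegral_comp_polarCoord_symm]
  have h : ∀ p ∈ polarCoord.target,
      ENNReal.ofReal p.1 • f ‖Complex.polarCoord.symm p‖ =
        (ENNReal.ofReal p.1 * f p.1) * 1 := by
    rintro p ⟨hp, -⟩
    rw [Complex.norm_polarCoord_symm, abs_of_pos hp, smul_eq_mul, mul_one]
  rw [setLIntegral_congr_fun polarCoord.open_target.measurableSet h, polarCoord_target,
    Measure.volume_eq_prod, ← Measure.prod_restrict,
    lintegral_prod_mul (f := fun x => ENNReal.ofReal x * f x) (g := fun _ => 1)
      (by fun_prop) (by fun_prop), mul_comm]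
  congr 1
  simp only [lintegral_const, one_mul, Measure.restrict_apply_univ, Real.volume_Ioo]
  ring_nf

lemma lintegral_Ioi_comp_sq_div (g : ℝ → ENNReal) {a : ℝ} (ha : 0 < a) :
    ∫⁻ x in Set.Ioi (0 : ℝ), ENNReal.ofReal (2 * x / a) * g (x ^ 2 / a) =
      ∫⁻ x in Set.Ioi (0 : ℝ), g x := by
  have himage : (fun x : ℝ => x ^ 2 / a) '' Set.Ioi 0 = Set.Ioi 0 := by
    ext y
    simp only [Set.mem_image, Set.mem_Ioi]
    constructor
    · rintro ⟨x, hx, rfl⟩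
      positivity
    · intro hy
      refine ⟨√(a * y), by positivity, ?_⟩
      rw [Real.sq_sqrt (by positivity)]
      field_simp
  have hinj : Set.InjOn (fun x : ℝ => x ^ 2 / a) (Set.Ioi 0) := by
    intro x hx y hy hxy
    have h := (div_left_inj' ha.ne').mp hxy
    exact (pow_left_inj₀ (le_of_lt hx) (le_of_lt hy) two_ne_zero).mp h
  have key := lintegral_image_eq_lintegral_abs_deriv_mul (f := fun x : ℝ => x ^ 2 / a)
    (f' := fun x => 2 * x / a) measurableSet_Ioi
    (fun x _ => by
      simpa using (((hasDerivAt_id x).pow 2).div_const a).hasDerivWithinAt) hinj g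
  rw [himage] at key
  rw [key]
  refine setLIntegral_congr_fun measurableSet_Ioi fun x (hx : 0 < x) => ?_
  rw [abs_of_pos (by positivity)]

lemma lintegral_norm_pow_mul_truncRpow (k : ℕ) {p : ℝ} (hp : -1 < p) (a : ℝ) :
    ∫⁻ z : ℂ, ENNReal.ofReal (‖z‖ ^ (2 * k)) * truncRpow p (a - ‖z‖ ^ 2) =
      ENNReal.ofReal
          (Real.pi * k.factorial * Real.Gamma (p + 1) / Real.Gamma (p + k + 2)) *
        truncRpow (p + k + 1) a := by
  rcases le_or_gt a 0 with ha | ha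
  · have h : ∀ z : ℂ, ENNReal.ofReal (‖z‖ ^ (2 * k)) * truncRpow p (a - ‖z‖ ^ 2) = 0 := by
      intro z
      have : ¬ 0 < a - ‖z‖ ^ 2 := by nlinarith [sq_nonneg ‖z‖]
      rw [truncRpow, if_neg this, ENNReal.ofReal_zero, mul_zero]
    rw [lintegral_congr h, lintegral_zero, truncRpow, if_neg ha.not_gt, ENNReal.ofReal_zero,
      mul_zero]
  have hk : (0 : ℝ) < k + 1 := by positivity
  have hp' : 0 < p + 1 := by linarith
  set B := ProbabilityTheory.beta (k + 1) (p + 1) with hB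
  have hBpos : 0 < B := ProbabilityTheory.beta_pos hk hp'
  have hpt : ∀ x ∈ Set.Ioi (0 : ℝ),
      ENNReal.ofReal x * (ENNReal.ofReal (x ^ (2 * k)) * truncRpow p (a - x ^ 2)) =
        ENNReal.ofReal (B / 2 * a ^ (p + k + 1)) *
          (ENNReal.ofReal (2 * x / a) * ProbabilityTheory.betaPDF (k + 1) (p + 1) (x ^ 2 / a)) := by
    intro x (hx : 0 < x)
    rw [truncRpow, ProbabilityTheory.betaPDF, ProbabilityTheory.betaPDFReal,
      ← ENNReal.ofReal_mul (by positivity), ← ENNReal.ofReal_mul (by positivity),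
      ← ENNReal.ofReal_mul (by positivity), ← ENNReal.ofReal_mul (by positivity)]
    congr 1
    by_cases hxa : x ^ 2 < a
    · have hsub : 0 < a - x ^ 2 := sub_pos.mpr hxa
      rw [if_pos hsub, if_pos ⟨by positivity, (div_lt_one ha).mpr hxa⟩, ← hB,
        add_sub_cancel_right, add_sub_cancel_right, Real.rpow_natCast,
        show 1 - x ^ 2 / a = (a - x ^ 2) / a by field_simp,
        Real.div_rpow hsub.le ha.le, Real.rpow_add ha, Real.rpow_add ha, Real.rpow_one,
        Real.rpow_natCast]
      have : a ^ p ≠ 0 := (Real.rpow_pos_of_pos ha p).ne'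
      rw [div_pow]
      field_simp
      ring
    · rw [if_neg (by linarith), if_neg (fun h => hxa ((div_lt_one ha).mp h.2))]
      simp
  have hbeta : ∫⁻ x in Set.Ioi (0 : ℝ), ProbabilityTheory.betaPDF (k + 1) (p + 1) x = 1 := by
    rw [← ProbabilityTheory.lintegral_betaPDF_eq_one hk hp',
      ← lintegral_indicator measurableSet_Ioi]
    refine lintegral_congr fun x => ?_
    by_cases hx : 0 < x
    · exact Set.indicator_of_mem hx _
    · rw [Set.indicator_of_notMem (s := Set.Ioi 0) hx,
        ProbabilityTheory.betaPDF_eq_zero_of_nonpos (not_lt.mp hx)]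
  rw [lintegral_complex_comp_norm
      (f := fun x => ENNReal.ofReal (x ^ (2 * k)) * truncRpow p (a - x ^ 2)) (by fun_prop),
    setLIntegral_congr_fun measurableSet_Ioi hpt, lintegral_const_mul' _ _ ENNReal.ofReal_ne_top,
    lintegral_Ioi_comp_sq_div _ ha, hbeta, mul_one, truncRpow, if_pos ha,
    ← ENNReal.ofReal_mul (by positivity)]
  have : 0 < Real.Gamma (p + 1) := Real.Gamma_pos_of_pos hp'
  have : 0 < Real.Gamma (p + k + 2) := Real.Gamma_pos_of_pos (by linarith)
  rw [← ENNReal.ofReal_mul (by positivity), hB, ProbabilityTheory.beta,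
    Real.Gamma_nat_eq_factorial, show (k : ℝ) + 1 + (p + 1) = p + k + 2 by ring]
  congr 1
  ring

lemma lintegral_prod_norm_pow_mul_truncRpow (n : ℕ) (r : Fin n → ℕ) {p : ℝ} (hp : -1 < p)
    (a : ℝ) :
    ∫⁻ z : Fin n → ℂ,
        ENNReal.ofReal (∏ i, ‖z i‖ ^ (2 * r i)) * truncRpow p (a - ∑ i, ‖z i‖ ^ 2) =
      ENNReal.ofReal (Real.pi ^ n * (∏ i, (r i).factorial : ℕ) * Real.Gamma (p + 1) /
          Real.Gamma (p + n + (∑ i, r i : ℕ) + 1)) *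
        truncRpow (p + n + (∑ i, r i : ℕ)) a := by
  induction n generalizing p a with
  | zero =>
    have : 0 < Real.Gamma (p + 1) := Real.Gamma_pos_of_pos (by linarith)
    rw [volume_pi, Measure.pi_of_empty (x := fun i => i.elim0), lintegral_dirac]
    simp [div_self this.ne']
  | succ n ih =>
    have hmp := (volume_preserving_piFinSuccAbove (fun _ : Fin (n + 1) => ℂ) 0).symm
    rw [← hmp.lintegral_comp_emb (MeasurableEquiv.measurableEmbedding _),
      Measure.volume_eq_prod, lintegral_prod_symm' _ (by fun_prop)]
    have hinner : ∀ w : Fin n → ℂ,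
        (∫⁻ z : ℂ, ENNReal.ofReal
            (∏ i, ‖(MeasurableEquiv.piFinSuccAbove (fun _ => ℂ) 0).symm (z, w) i‖ ^ (2 * r i)) *
          truncRpow p (a - ∑ i,
            ‖(MeasurableEquiv.piFinSuccAbove (fun _ => ℂ) 0).symm (z, w) i‖ ^ 2)) =
        ENNReal.ofReal (Real.pi * (r 0).factorial * Real.Gamma (p + 1) /
            Real.Gamma (p + r 0 + 2)) *
          (ENNReal.ofReal (∏ i, ‖w i‖ ^ (2 * r i.succ)) *
            truncRpow (p + r 0 + 1) (a - ∑ i, ‖w i‖ ^ 2)) := by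
      intro w
      rw [mul_left_comm, ← lintegral_norm_pow_mul_truncRpow (r 0) hp,
        ← lintegral_const_mul' _ _ ENNReal.ofReal_ne_top]
      refine lintegral_congr fun z => ?_
      simp only [MeasurableEquiv.piFinSuccAbove_symm_apply, Fin.insertNthEquiv_zero,
        Fin.consEquiv_apply, Fin.prod_univ_succ, Fin.sum_univ_succ, Fin.cons_zero, Fin.cons_succ]
      rw [mul_comm (‖z‖ ^ _), ENNReal.ofReal_mul (by positivity), mul_assoc,
        sub_add_eq_sub_sub_swap]
    have hr : (0 : ℝ) ≤ r 0 := by positivity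
    simp_rw [hinner]
    rw [lintegral_const_mul' _ _ ENNReal.ofReal_ne_top, ih (fun i => r i.succ) (by linarith),
      ← mul_assoc]
    have h1 : 0 < Real.Gamma (p + 1) := Real.Gamma_pos_of_pos (by linarith)
    have h2 : 0 < Real.Gamma (p + r 0 + 2) := Real.Gamma_pos_of_pos (by linarith)
    rw [← ENNReal.ofReal_mul (by positivity), Fin.prod_univ_succ, Fin.sum_univ_succ]
    push_cast
    congr 2
    · rw [show p + r 0 + 1 + 1 = p + r 0 + 2 by ring,
        show p + r 0 + 1 + n + (∑ i : Fin n, (r i.succ : ℝ)) + 1 =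
          p + (n + 1) + (r 0 + ∑ i : Fin n, (r i.succ : ℝ)) + 1 by ring]
      field_simp
      ring
    · ring

lemma measurableSet_unitBall (n : ℕ) : MeasurableSet (UnitBall n) :=
  measurableSet_lt (f := fun z : Fin n → ℂ => ∑ i, ‖z i‖ ^ 2) (by fun_prop) measurable_const

@[fun_prop]
lemma measurable_bergWeight (n : ℕ) (lam : ℝ) : Measurable (bergWeight n lam) := by
  unfold bergWeight
  fun_prop

lemma lintegral_bergMeasure_prod_norm_pow (n : ℕ) {lam : ℝ} (hlam : n < lam) (r : Fin n → ℕ) :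
    ∫⁻ z, ENNReal.ofReal (∏ i, ‖z i‖ ^ (2 * r i)) ∂(bergMeasure n lam) =
      ENNReal.ofReal ((∏ i, (r i).factorial : ℕ) * Real.Gamma lam /
        Real.Gamma (lam + (∑ i, r i : ℕ))) := by
  have hn : (0 : ℝ) ≤ n := n.cast_nonneg
  have hsum : (0 : ℝ) ≤ (∑ i, r i : ℕ) := Nat.cast_nonneg _
  have h1 : 0 < Real.Gamma lam := Real.Gamma_pos_of_pos (by linarith)
  have h2 : 0 < Real.Gamma (lam - n) := Real.Gamma_pos_of_pos (by linarith)
  have hpt : ∀ z : Fin n → ℂ,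
      (UnitBall n).indicator ((fun z : Fin n → ℂ => ENNReal.ofReal (bergWeight n lam z)) *
        fun z => ENNReal.ofReal (∏ i, ‖z i‖ ^ (2 * r i))) z =
      ENNReal.ofReal (Real.Gamma lam / (Real.pi ^ n * Real.Gamma (lam - n))) *
        (ENNReal.ofReal (∏ i, ‖z i‖ ^ (2 * r i)) *
          truncRpow (lam - n - 1) (1 - ∑ i, ‖z i‖ ^ 2)) := by
    intro z
    by_cases hz : ∑ i, ‖z i‖ ^ 2 < 1
    · rw [Set.indicator_of_mem (s := UnitBall n) hz, Pi.mul_apply, bergWeight, truncRpow,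
        if_pos (sub_pos.mpr hz), ENNReal.ofReal_mul (by positivity)]
      ring
    · rw [Set.indicator_of_notMem (s := UnitBall n) hz, truncRpow,
        if_neg (by linarith), ENNReal.ofReal_zero, mul_zero, mul_zero]
  rw [bergMeasure, lintegral_withDensity_eq_lintegral_mul _ (by fun_prop) (by fun_prop),
    ← lintegral_indicator (measurableSet_unitBall n), lintegral_congr hpt,
    lintegral_const_mul' _ _ ENNReal.ofReal_ne_top,
    lintegral_prod_norm_pow_mul_truncRpow n r (by linarith), truncRpow, if_pos one_pos,
    Real.one_rpow, ENNReal.ofReal_one, mul_one, ← ENNReal.ofReal_mul (by positivity)]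
  congr 1
  rw [sub_add_cancel, show lam - n - 1 + n + (∑ i, r i : ℕ) + 1 = lam + (∑ i, r i : ℕ) by ring]
  field_simp

lemma integral_bergMeasure_monomial_self (n : ℕ) {lam : ℝ} (hlam : n < lam) (r : Fin n → ℕ) :
    ∫ z, (∏ i, z i ^ r i) * (starRingEnd ℂ) (∏ i, z i ^ r i) ∂(bergMeasure n lam) =
      (((∏ i, (r i).factorial : ℕ) * Real.Gamma lam /
        Real.Gamma (lam + (∑ i, r i : ℕ)) : ℝ) : ℂ) := by
  have hn : (0 : ℝ) ≤ n := n.cast_nonneg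
  have hsum : (0 : ℝ) ≤ (∑ i, r i : ℕ) := Nat.cast_nonneg _
  have h1 : 0 < Real.Gamma lam := Real.Gamma_pos_of_pos (by linarith)
  have h2 : 0 < Real.Gamma (lam + (∑ i, r i : ℕ)) := Real.Gamma_pos_of_pos (by linarith)
  have hpt : ∀ z : Fin n → ℂ, (∏ i, z i ^ r i) * (starRingEnd ℂ) (∏ i, z i ^ r i) =
      ((∏ i, ‖z i‖ ^ (2 * r i) : ℝ) : ℂ) := by
    intro z
    rw [Complex.mul_conj', ← Complex.ofReal_pow, norm_prod, ← Finset.prod_pow]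
    simp only [norm_pow, ← pow_mul, mul_comm]
  simp_rw [hpt]
  rw [integral_complex_ofReal, integral_eq_lintegral_of_nonneg_ae
      (Filter.Eventually.of_forall fun z => by positivity)
      (Measurable.aestronglyMeasurable (by fun_prop)),
    lintegral_bergMeasure_prod_norm_pow n hlam, ENNReal.toReal_ofReal (by positivity)]

lemma integral_bergMeasure_monomial_of_ne (n : ℕ) (lam : ℝ) {r s : Fin n → ℕ} (hrs : r ≠ s) :
    ∫ z, (∏ i, z i ^ r i) * (starRingEnd ℂ) (∏ i, z i ^ s i) ∂(bergMeasure n lam) = 0 := by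
  obtain ⟨i, hi⟩ := Function.ne_iff.mp hrs
  let c : Fin n → Circle := fun j => if j = i then Circle.exp (Real.pi / (r i - s i)) else 1
  let T : (Fin n → ℂ) ≃ᵐ (Fin n → ℂ) :=
    MeasurableEquiv.piCongrRight fun j => (rotation (c j)).toMeasurableEquiv
  have hT : MeasurePreserving T := volume_preserving_pi fun j => (rotation (c j)).measurePreserving
  have hTapply : ∀ z j, T z j = c j * z j := fun z j => rfl
  have hnorm : ∀ z, ∑ j, ‖T z j‖ ^ 2 = ∑ j, ‖z j‖ ^ 2 := by
    intro z
    simp only [hTapply, norm_mul, Circle.norm_coe, one_mul]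
  have hc : (∏ j, (c j : ℂ) ^ r j) * (starRingEnd ℂ) (∏ j, (c j : ℂ) ^ s j) = -1 := by
    have hne : (r i : ℂ) - s i ≠ 0 := sub_ne_zero.mpr (by exact_mod_cast hi)
    rw [map_prod, ← Finset.prod_mul_distrib, Finset.prod_eq_single i]
    · simp only [c, if_true, Circle.coe_exp, ← Complex.exp_conj, ← Complex.exp_nat_mul,
        ← Complex.exp_add]
      rw [← Complex.exp_pi_mul_I]
      congr 1
      simp only [map_mul, map_natCast, Complex.conj_ofReal, Complex.conj_I]
      push_cast
      field_simp
      ring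
    · intro j _ hj
      simp [c, hj]
    · simp
  let F : (Fin n → ℂ) → ℂ := (UnitBall n).indicator fun z =>
    (ENNReal.ofReal (bergWeight n lam z)).toReal •
      ((∏ i, z i ^ r i) * (starRingEnd ℂ) (∏ i, z i ^ s i))
  have hF : ∀ z, F (T z) = -F z := by
    intro z
    have hmem : T z ∈ UnitBall n ↔ z ∈ UnitBall n := by
      simp only [UnitBall, Set.mem_ofPred_eq, hnorm]
    by_cases hz : z ∈ UnitBall n
    · simp only [F]
      rw [Set.indicator_of_mem hz, Set.indicator_of_mem (hmem.mpr hz), bergWeight, hnorm,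
        ← bergWeight, ← smul_neg]
      congr 1
      simp only [hTapply, mul_pow, Finset.prod_mul_distrib, map_mul]
      linear_combination (∏ i, z i ^ r i) * (starRingEnd ℂ) (∏ i, z i ^ s i) * hc
    · simp only [F]
      rw [Set.indicator_of_notMem hz, Set.indicator_of_notMem (fun h => hz (hmem.mp h)), neg_zero]
  rw [bergMeasure, integral_withDensity_eq_integral_toReal_smul (by fun_prop)
      (Filter.Eventually.of_forall fun z => ENNReal.ofReal_lt_top),
    ← integral_indicator (measurableSet_unitBall n)]
  have h := hT.integral_comp' F
  simp_rw [hF, integral_neg] at h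
  exact self_eq_neg.mp h.symm

lemma prod_range_add_div_eq_Gamma {x : ℝ} (hx : 0 < x) {y : ℝ} (hy : 0 ≤ y) (N : ℕ) :
    ∏ k ∈ Finset.range N, ((x + k + y) / (x + k)) =
      Real.Gamma (x + N + y) * Real.Gamma x / (Real.Gamma (x + y) * Real.Gamma (x + N)) := by
  have h1 : 0 < Real.Gamma x := Real.Gamma_pos_of_pos hx
  have h2 : 0 < Real.Gamma (x + y) := Real.Gamma_pos_of_pos (by linarith)
  induction N with
  | zero => simp; field_simp
  | succ N ih =>
    have hN : (0 : ℝ) ≤ N := N.cast_nonneg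
    have h3 : 0 < Real.Gamma (x + N) := Real.Gamma_pos_of_pos (by linarith)
    have h4 : 0 < x + N := by linarith
    rw [Finset.prod_range_succ, ih]
    push_cast
    rw [show x + (N + 1) + y = (x + N + y) + 1 by ring, ← add_assoc x,
      Real.Gamma_add_one (by linarith : x + N + y ≠ 0), Real.Gamma_add_one h4.ne']
    field_simp

/-- The inner product identity ⟨z^r, z^s⟩_{λ,#} = ⟨A_λ z^r, B_λ z^s⟩_{λ+2m}
= δ(r,s) r! Γ(λ)/Γ(λ+|r|) for the analytically continued Bergman space, where
A_λ, B_λ act on monomials by the displayed eigenvalue products. -/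
theorem analytic_continuation_monomial_inner_product
    (n : ℕ) (hn : 1 ≤ n) (lam : ℝ) (hlam : 0 < lam)
    (m : ℕ) (hm : (n : ℝ) < lam + 2 * m)
    (r s : Fin n → ℕ) :
    ((∏ k ∈ Finset.Ico m (2 * m),
        ((lam + k + (∑ i, r i : ℕ)) / (lam + k)) : ℝ) : ℂ) *
      ((∏ k ∈ Finset.range m,
        ((lam + k + (∑ i, s i : ℕ)) / (lam + k)) : ℝ) : ℂ) *
      ∫ z, (∏ i, z i ^ r i) * (starRingEnd ℂ) (∏ i, z i ^ s i)
        ∂(bergMeasure n (lam + 2 * m))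
      = if r = s then
          ((∏ i, Nat.factorial (r i) : ℕ) : ℂ) * (Real.Gamma lam : ℂ) /
            (Real.Gamma (lam + (∑ i, r i : ℕ)) : ℂ)
        else 0 := by
  split_ifs with hrs
  · subst hrs
    have hsum : (0 : ℝ) ≤ (∑ i, r i : ℕ) := Nat.cast_nonneg _
    have hm0 : (0 : ℝ) ≤ m := m.cast_nonneg
    have h1 : 0 < Real.Gamma (lam + 2 * m) := Real.Gamma_pos_of_pos (by linarith)
    have h2 : 0 < Real.Gamma (lam + 2 * m + (∑ i, r i : ℕ)) := Real.Gamma_pos_of_pos (by linarith)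
    have h3 : 0 < Real.Gamma (lam + (∑ i, r i : ℕ)) := Real.Gamma_pos_of_pos (by linarith)
    have hprod := prod_range_add_div_eq_Gamma hlam hsum (2 * m)
    rw [← Finset.prod_range_mul_prod_Ico _ (by omega : m ≤ 2 * m), mul_comm] at hprod
    rw [integral_bergMeasure_monomial_self n hm, ← Complex.ofReal_mul, hprod,
      ← Complex.ofReal_mul]
    norm_cast
    push_cast at *
    field_simp
  · rw [integral_bergMeasure_monomial_of_ne n _ hrs, mul_zero]
end
end

section
/- Let n ≥ 2 and let λ ∈ ℝ. Let z₀' ∈ ℂ^{n−1} be the vector with every coordinate equal to 1/√(2(n−1)), and for t ∈ 𝕋^{n−1} and s ∈ ℝ define h(t,s) ∈ ℂⁿ by h(t,s) = (t₁ z₀'₁/cosh s, …, t_{n−1} z₀'_{n−1}/cosh s, tanh s); then h(t,s) ∈ 𝔹ⁿ. For all t, t' ∈ 𝕋^{n−1} and s, s' ∈ ℝ: (cosh s)^{−λ} · (cosh s')^{−λ} · (1 − ⟨h(t,s), h(t',s')⟩)^{−λ} = (cosh(s−s') − (1/(2(n−1))) Σ_{i=1}^{n−1} t_i·conj(t'_i))^{−λ},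 where all complex powers are principal-branch powers. (This is the computation D_λ(h)·conj(D_λ(k))·K_λ(h·z₀, k·z₀) = e^{−2πiλ(x−x')}(cosh(s−s') − (1/(2(n−1)))Σ t_i (t'_i)^{−1})^{−λ} for the quasi-hyperbolic subgroup H(n), with the trivially cancelling factors e^{∓2πiλx} omitted.) -/
open Complex

noncomputable section

/-- The orbit point h(t,s) = (t₁ z₀'₁/cosh s, …, t_{n−1} z₀'_{n−1}/cosh s, tanh s)
∈ ℂⁿ (with n = m+1), where z₀' has all coordinates 1/√(2(n−1)). -/
def hypPt (m : ℕ) (t : Fin m → ℂ) (s : ℝ) : Fin (m + 1) → ℂ :=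
  Fin.snoc (fun i => t i * ((1 / Real.sqrt (2 * m) : ℝ) : ℂ) / (Real.cosh s : ℂ))
    ((Real.tanh s : ℝ) : ℂ)

theorem ofReal_mul_cpow_of_pos {r : ℝ} (hr : 0 < r) (x c : ℂ) :
    ((r : ℂ) * x) ^ c = (r : ℂ) ^ c * x ^ c := by
  have hr' : (r : ℂ) ≠ 0 := ofReal_ne_zero.mpr hr.ne'
  rcases eq_or_ne x 0 with rfl | hx
  · rcases eq_or_ne c 0 with rfl | hc
    · simp
    · simp [zero_cpow hc]
  · rw [cpow_def_of_ne_zero (mul_ne_zero hr' hx), cpow_def_of_ne_zero hr',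
      cpow_def_of_ne_zero hx, log_ofReal_mul hr hx, ← exp_add, ofReal_log hr.le, add_mul]

theorem one_div_sqrt_two_mul_natCast_sq (m : ℕ) :
    (1 / Real.sqrt (2 * m)) ^ 2 = 1 / (2 * (m : ℝ)) := by
  rw [div_pow, one_pow, Real.sq_sqrt (by positivity)]

theorem hypPt_mem_unitBall {m : ℕ} (hm : 1 ≤ m) {t : Fin m → ℂ} (ht : ∀ i, ‖t i‖ = 1) (s : ℝ) :
    hypPt m t s ∈ UnitBall (m + 1) := by
  have hc := Real.cosh_pos s
  have hm' : (m : ℝ) ≠ 0 := by exact_mod_cast (by omega : m ≠ 0)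
  have hcoord : ∀ i, ‖t i * ((1 / Real.sqrt (2 * m) : ℝ) : ℂ) / (Real.cosh s : ℂ)‖ ^ 2
      = 1 / (2 * (m : ℝ)) / Real.cosh s ^ 2 := fun i => by
    rw [norm_div, norm_mul, ht, norm_real, norm_real, one_mul, div_pow, Real.norm_eq_abs,
      Real.norm_eq_abs, sq_abs, sq_abs, one_div_sqrt_two_mul_natCast_sq]
  change ∑ i, ‖hypPt m t s i‖ ^ 2 < 1
  simp only [hypPt, Fin.sum_univ_castSucc, Fin.snoc_castSucc, Fin.snoc_last, hcoord,
    Finset.sum_const, Finset.card_univ, Fintype.card_fin, nsmul_eq_mul, norm_real,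
    Real.norm_eq_abs, sq_abs, Real.tanh_eq_sinh_div_cosh, div_pow]
  have hsum : (m : ℝ) * (1 / (2 * (m : ℝ)) / Real.cosh s ^ 2)
      + Real.sinh s ^ 2 / Real.cosh s ^ 2 = (1 / 2 + Real.sinh s ^ 2) / Real.cosh s ^ 2 := by
    field_simp
  rw [hsum, div_lt_one (by positivity), Real.cosh_sq]
  linarith

theorem cosh_mul_cosh_mul_one_sub_herm_hypPt (m : ℕ) (t t' : Fin m → ℂ) (s s' : ℝ) :
    (Real.cosh s : ℂ) * ((Real.cosh s' : ℂ) *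
        (1 - herm (m + 1) (hypPt m t s) (hypPt m t' s')))
      = (Real.cosh (s - s') : ℂ) -
          (1 / (2 * (m : ℂ))) * ∑ i, t i * (starRingEnd ℂ) (t' i) := by
  have hc : (Real.cosh s : ℂ) ≠ 0 := ofReal_ne_zero.mpr (Real.cosh_pos s).ne'
  have hc' : (Real.cosh s' : ℂ) ≠ 0 := ofReal_ne_zero.mpr (Real.cosh_pos s').ne'
  have hsq : ((1 / Real.sqrt (2 * m) : ℝ) : ℂ) ^ 2 = 1 / (2 * (m : ℂ)) := by
    rw [← ofReal_pow, one_div_sqrt_two_mul_natCast_sq]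
    push_cast
    rfl
  have hsum : ∑ i, t i * ((1 / Real.sqrt (2 * m) : ℝ) : ℂ) / (Real.cosh s : ℂ) *
        ((starRingEnd ℂ) (t' i) * ((1 / Real.sqrt (2 * m) : ℝ) : ℂ) / (Real.cosh s' : ℂ))
      = (1 / (2 * (m : ℂ))) * (∑ i, t i * (starRingEnd ℂ) (t' i)) /
          ((Real.cosh s : ℂ) * (Real.cosh s' : ℂ)) := by
    rw [← hsq, Finset.mul_sum, Finset.sum_div]
    refine Finset.sum_congr rfl fun i _ => ?_
    rw [div_mul_div_comm]
    ring
  simp only [herm, hypPt, Fin.sum_univ_castSucc, Fin.snoc_castSucc, Fin.snoc_last, map_div₀,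
    map_mul, conj_ofReal]
  rw [hsum, Real.cosh_sub, Real.tanh_eq_sinh_div_cosh, Real.tanh_eq_sinh_div_cosh,
    ofReal_div, ofReal_div, ofReal_sub, ofReal_mul, ofReal_mul]
  generalize (1 / (2 * (m : ℂ))) * (∑ i, t i * (starRingEnd ℂ) (t' i)) = S
  field_simp
  ring

/-- For the quasi-hyperbolic subgroup, with n = m+1 ≥ 2: h(t,s) ∈ 𝔹ⁿ, and
(cosh s)^{−λ}(cosh s')^{−λ}(1 − ⟨h(t,s),h(t',s')⟩)^{−λ}
= (cosh(s−s') − (1/(2(n−1))) Σ tᵢ conj(t'ᵢ))^{−λ}. -/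
theorem quasi_hyperbolic_kernel_computation
    (m : ℕ) (hm : 1 ≤ m) (lam : ℝ)
    (t t' : Fin m → ℂ) (ht : ∀ i, ‖t i‖ = 1) (ht' : ∀ i, ‖t' i‖ = 1)
    (s s' : ℝ) :
    hypPt m t s ∈ UnitBall (m + 1) ∧
    ((Real.cosh s : ℂ) ^ (-(lam : ℂ))) * ((Real.cosh s' : ℂ) ^ (-(lam : ℂ))) *
        (1 - herm (m + 1) (hypPt m t s) (hypPt m t' s')) ^ (-(lam : ℂ))
      = ((Real.cosh (s - s') : ℂ) -
          (1 / (2 * (m : ℂ))) * ∑ i, t i * (starRingEnd ℂ) (t' i)) ^ (-(lam : ℂ)) := by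
  refine ⟨hypPt_mem_unitBall hm ht s, ?_⟩
  rw [← cosh_mul_cosh_mul_one_sub_herm_hypPt, ofReal_mul_cpow_of_pos (Real.cosh_pos s),
    ofReal_mul_cpow_of_pos (Real.cosh_pos s'), mul_assoc]
end
end
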